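/- arXiv:2112.07643 — 3 statements merged into one kernel-verified Lean document; each statement's English description precedes it below -/
import Mathlib

section
/- Let Z be a real Banach space, let a > 0 and b > 0, let t₀ < T be real, and let f : ℝ → Z be continuous on [t₀, T]. Then for every t ∈ [t₀, T], (1/Γ(a)) ∫_{t₀}^{t} (t−u)^{a−1} [ (1/Γ(b)) ∫_{t₀}^{u} (u−r)^{b−1} f(r) dr ] du = (1/Γ(a+b)) ∫_{t₀}^{t} (t−r)^{a+b−1} f(r) dr; that is, the Riemann–Liouville fractional integrals satisfy the semigroup property _{t₀}I_t^a (_{t₀}I_t^b f) = _{t₀}I_t^{a+b} f for continuous f. -/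
open MeasureTheory intervalIntegral

/-- The Beta integral over an arbitrary interval. -/
theorem integral_sub_rpow_mul_sub_rpow {a b r t : ℝ} (ha : 0 < a) (hb : 0 < b) (hrt : r < t) :
    ∫ u in r..t, (t - u) ^ (a - 1) * (u - r) ^ (b - 1) =
      Real.Gamma a * Real.Gamma b / Real.Gamma (a + b) * (t - r) ^ (a + b - 1) := by
  have hpos : 0 < t - r := sub_pos.2 hrt
  have hsub : ∫ u in r..t, (t - u) ^ (a - 1) * (u - r) ^ (b - 1) =
      ∫ x in (0 : ℝ)..t - r, x ^ (a - 1) * (t - r - x) ^ (b - 1) := by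
    have h := intervalIntegral.integral_comp_sub_left (a := r) (b := t)
      (fun x : ℝ => x ^ (a - 1) * (t - r - x) ^ (b - 1)) t
    rw [sub_self] at h
    rw [← h]
    refine intervalIntegral.integral_congr fun u _ => ?_
    simp only [show t - r - (t - u) = u - r by ring]
  have hscaled := Complex.betaIntegral_scaled (a : ℂ) (b : ℂ) hpos
  rw [Complex.betaIntegral_eq_Gamma_mul_div _ _ (by simpa) (by simpa)] at hscaled
  rw [hsub]
  apply Complex.ofReal_injective
  rw [← intervalIntegral.integral_ofReal]
  calc ∫ x in (0 : ℝ)..t - r, ((x ^ (a - 1) * (t - r - x) ^ (b - 1) : ℝ) : ℂ)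
      = ∫ x in (0 : ℝ)..t - r,
          (x : ℂ) ^ ((a : ℂ) - 1) * (((t - r : ℝ) : ℂ) - x) ^ ((b : ℂ) - 1) := by
        refine intervalIntegral.integral_congr fun x hx => ?_
        rw [Set.uIcc_of_le hpos.le] at hx
        simp only [Complex.ofReal_mul, Complex.ofReal_cpow hx.1,
          Complex.ofReal_cpow (sub_nonneg.2 hx.2), Complex.ofReal_sub, Complex.ofReal_one]
    _ = _ := by
        rw [hscaled]
        simp only [Complex.ofReal_mul, Complex.ofReal_div, Complex.ofReal_cpow hpos.le,
          ← Complex.Gamma_ofReal, Complex.ofReal_sub, Complex.ofReal_add, Complex.ofReal_one]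
        ring

/-- The power kernel `x ^ (c - 1)` truncated to `[0, L)` is integrable. -/
theorem integrable_indicator_Ico_rpow {c L : ℝ} (hc : 0 < c) (hL : 0 ≤ L) :
    Integrable ((Set.Ico 0 L).indicator fun x : ℝ => x ^ (c - 1)) := by
  rw [integrable_indicator_iff measurableSet_Ico, integrableOn_Ico_iff_integrableOn_Ioo,
    ← integrableOn_Ioc_iff_integrableOn_Ioo, ← intervalIntegrable_iff_integrableOn_Ioc_of_le hL]
  exact intervalIntegrable_rpow' (by linarith)

/-- Fubini for the triangle `t₀ < r ≤ u ≤ t` with a product of two weakly singular kernels. -/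
theorem integral_rpow_smul_integral_rpow_smul {Z : Type*} [NormedAddCommGroup Z] [NormedSpace ℝ Z]
    [CompleteSpace Z] {a b t₀ t : ℝ} (ha : 0 < a) (hb : 0 < b) (ht : t₀ ≤ t)
    {f : ℝ → Z} (hf : ContinuousOn f (Set.Icc t₀ t)) :
    ∫ u in t₀..t, (t - u) ^ (a - 1) • ∫ r in t₀..u, (u - r) ^ (b - 1) • f r =
      ∫ r in t₀..t, (∫ u in r..t, (t - u) ^ (a - 1) * (u - r) ^ (b - 1)) • f r := by
  set k : ℝ → ℝ → ℝ := fun c => (Set.Ico 0 (t - t₀)).indicator fun x : ℝ => x ^ (c - 1)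
  set g : ℝ → Z := (Set.Ioc t₀ t).indicator f with hg
  have hk_mem {c x : ℝ} (h0 : 0 ≤ x) (hx : x < t - t₀) : k c x = x ^ (c - 1) :=
    Set.indicator_of_mem (Set.mem_Ico.2 ⟨h0, hx⟩) _
  have hk_int {c : ℝ} (hc : 0 < c) : Integrable (k c) :=
    integrable_indicator_Ico_rpow hc (sub_nonneg.2 ht)
  have hg_meas : AEStronglyMeasurable g :=
    (aestronglyMeasurable_indicator_iff measurableSet_Ioc).2
      ((hf.mono Set.Ioc_subset_Icc_self).aestronglyMeasurable measurableSet_Ioc)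
  obtain ⟨C, hC⟩ := isCompact_Icc.exists_bound_of_continuousOn hf
  have hg_bound (r : ℝ) : ‖g r‖ ≤ max C 0 := by
    by_cases hr : r ∈ Set.Ioc t₀ t
    · simpa [hg, hr] using Or.inl (hC r (Set.Ioc_subset_Icc_self hr))
    · simp [hg, hr]
  have hprod : Integrable (Function.uncurry fun u r => (k a (t - u) * k b (u - r)) • g r)
      (volume.prod volume) := by
    have h := (Integrable.convolution_integrand (ContinuousLinearMap.mul ℝ ℝ)
      ((hk_int ha).comp_sub_left t) (hk_int hb).comp_neg).swap
    refine (h.smul_bdd (f := fun p : ℝ × ℝ => g p.2) (max C 0) hg_meas.comp_snd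
      (Filter.Eventually.of_forall fun p => hg_bound p.2)).congr
      (Filter.Eventually.of_forall fun p => ?_)
    simp [Function.uncurry]
  have hleft : ∫ u in t₀..t, (t - u) ^ (a - 1) • ∫ r in t₀..u, (u - r) ^ (b - 1) • f r =
      ∫ u, ∫ r, (k a (t - u) * k b (u - r)) • g r := by
    rw [intervalIntegral.integral_of_le ht, ← MeasureTheory.integral_indicator measurableSet_Ioc]
    congr 1 with u
    by_cases hu : u ∈ Set.Ioc t₀ t
    · have hku : k a (t - u) = (t - u) ^ (a - 1) :=
        hk_mem (by linarith [hu.2]) (by linarith [hu.1])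
      rw [Set.indicator_of_mem hu, intervalIntegral.integral_of_le hu.1.le,
        ← MeasureTheory.integral_indicator measurableSet_Ioc, ← MeasureTheory.integral_smul]
      congr 1 with r
      by_cases hr : r ∈ Set.Ioc t₀ u
      · have hkr : k b (u - r) = (u - r) ^ (b - 1) :=
          hk_mem (by linarith [hr.2]) (by linarith [hr.1, hu.2])
        have hgr : g r = f r :=
          Set.indicator_of_mem (Set.mem_Ioc.2 ⟨hr.1, hr.2.trans hu.2⟩) _
        rw [Set.indicator_of_mem hr, hku, hkr, hgr, mul_smul]
      · rw [Set.indicator_of_notMem hr, smul_zero]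
        by_cases hr₀ : t₀ < r
        · have hkr : k b (u - r) = 0 :=
            Set.indicator_of_notMem (fun h => hr ⟨hr₀, by linarith [h.1]⟩) _
          rw [hkr, mul_zero, zero_smul]
        · have hgr : g r = 0 := Set.indicator_of_notMem (fun h => hr₀ h.1) _
          rw [hgr, smul_zero]
    · have hku : k a (t - u) = 0 :=
        Set.indicator_of_notMem (fun h => hu ⟨by linarith [h.2], by linarith [h.1]⟩) _
      simp [Set.indicator_of_notMem hu, hku]
  have hright : ∫ r, ∫ u, (k a (t - u) * k b (u - r)) • g r =
      ∫ r in t₀..t, (∫ u in r..t, (t - u) ^ (a - 1) * (u - r) ^ (b - 1)) • f r := by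
    rw [intervalIntegral.integral_of_le ht, ← MeasureTheory.integral_indicator measurableSet_Ioc]
    congr 1 with r
    rw [_root_.integral_smul_const]
    by_cases hr : r ∈ Set.Ioc t₀ t
    · have hgr : g r = f r := Set.indicator_of_mem hr _
      rw [Set.indicator_of_mem hr, hgr, intervalIntegral.integral_of_le hr.2,
        ← integral_Icc_eq_integral_Ioc, ← MeasureTheory.integral_indicator measurableSet_Icc]
      congr 2 with u
      by_cases hu : u ∈ Set.Icc r t
      · have hku : k a (t - u) = (t - u) ^ (a - 1) :=
          hk_mem (by linarith [hu.2]) (by linarith [hu.1, hr.1])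
        have hkr : k b (u - r) = (u - r) ^ (b - 1) :=
          hk_mem (by linarith [hu.1]) (by linarith [hr.1, hu.2])
        rw [Set.indicator_of_mem hu, hku, hkr]
      · rw [Set.indicator_of_notMem hu]
        by_cases hru : r ≤ u
        · have hku : k a (t - u) = 0 :=
            Set.indicator_of_notMem (fun h => hu ⟨hru, by linarith [h.1]⟩) _
          rw [hku, zero_mul]
        · have hkr : k b (u - r) = 0 :=
            Set.indicator_of_notMem (fun h => hru (by linarith [h.1])) _
          rw [hkr, mul_zero]
    · have hgr : g r = 0 := Set.indicator_of_notMem hr _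
      rw [Set.indicator_of_notMem hr, hgr, smul_zero]
  rw [hleft, integral_integral_swap hprod, hright]

/-- Semigroup property of Riemann–Liouville fractional integrals:
`_{t₀}I_t^a (_{t₀}I_t^b f) = _{t₀}I_t^{a+b} f` for `f` continuous on `[t₀, T]`. -/
theorem rl_integral_semigroup {Z : Type*} [NormedAddCommGroup Z] [NormedSpace ℝ Z]
    [CompleteSpace Z] (a b t₀ T : ℝ) (ha : 0 < a) (hb : 0 < b) (htT : t₀ < T)
    (f : ℝ → Z) (hf : ContinuousOn f (Set.Icc t₀ T)) :
    ∀ t ∈ Set.Icc t₀ T,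
      (1 / Real.Gamma a) •
          ∫ u in t₀..t, (t - u) ^ (a - 1) •
            ((1 / Real.Gamma b) • ∫ r in t₀..u, (u - r) ^ (b - 1) • f r) =
        (1 / Real.Gamma (a + b)) • ∫ r in t₀..t, (t - r) ^ (a + b - 1) • f r := by
  intro t ht
  have hΓa := (Real.Gamma_pos_of_pos ha).ne'
  have hΓb := (Real.Gamma_pos_of_pos hb).ne'
  have hbeta : ∫ r in t₀..t, (∫ u in r..t, (t - u) ^ (a - 1) * (u - r) ^ (b - 1)) • f r =
      (Real.Gamma a * Real.Gamma b / Real.Gamma (a + b)) •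
        ∫ r in t₀..t, (t - r) ^ (a + b - 1) • f r := by
    rw [← intervalIntegral.integral_smul, intervalIntegral.integral_of_le ht.1,
      intervalIntegral.integral_of_le ht.1, integral_Ioc_eq_integral_Ioo,
      integral_Ioc_eq_integral_Ioo]
    refine setIntegral_congr_fun measurableSet_Ioo fun r hr => ?_
    simp only [integral_sub_rpow_mul_sub_rpow ha hb hr.2, mul_smul]
  simp_rw [smul_comm _ (1 / Real.Gamma b)]
  rw [intervalIntegral.integral_smul,
    integral_rpow_smul_integral_rpow_smul ha hb ht.1 (hf.mono (Set.Icc_subset_Icc_right ht.2)),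
    hbeta, smul_smul, smul_smul]
  congr 1
  field_simp
end

section
/- Let 0 < η < 1 and let c < p < t be real numbers. Then ∫_{p}^{t} (t−s)^{η−1} (s−c)^{−η−1} ds = (t−p)^{η} / ( η (p−c)^{η} (t−c) ). -/
open MeasureTheory intervalIntegral

/-- `∫_{p}^{t} (t−s)^{η−1} (s−c)^{−η−1} ds = (t−p)^{η} / (η (p−c)^{η} (t−c))`
for `c < p < t` and `0 < η < 1`. -/
theorem integral_kernel_product_eq (η c p t : ℝ) (hη0 : 0 < η) (hη1 : η < 1)
    (hcp : c < p) (hpt : p < t) :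
    ∫ s in p..t, (t - s) ^ (η - 1) * (s - c) ^ (-η - 1) =
      (t - p) ^ η / (η * (p - c) ^ η * (t - c)) := by
  have htc : 0 < t - c := by linarith
  have hcont : ContinuousOn
      (fun s : ℝ => -((t - s) ^ η * (s - c) ^ (-η)) / (η * (t - c))) (Set.Icc p t) := by
    refine ContinuousOn.div_const (ContinuousOn.neg (ContinuousOn.mul ?_ ?_)) _
    · exact ContinuousOn.rpow_const (by fun_prop) fun _ _ => Or.inr hη0.le
    · exact ContinuousOn.rpow_const (by fun_prop) fun x hx =>
        Or.inl (by linarith [hx.1] : 0 < x - c).ne'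
  have hderiv : ∀ x ∈ Set.Ioo p t, HasDerivAt
      (fun s : ℝ => -((t - s) ^ η * (s - c) ^ (-η)) / (η * (t - c)))
      ((t - x) ^ (η - 1) * (x - c) ^ (-η - 1)) x := by
    intro x hx
    have h₁ : 0 < t - x := by linarith [hx.2]
    have h₂ : 0 < x - c := by linarith [hx.1]
    have d₁ := ((hasDerivAt_id x).const_sub t).rpow_const (p := η) (Or.inl h₁.ne')
    have d₂ := ((hasDerivAt_id x).sub_const c).rpow_const (p := -η) (Or.inl h₂.ne')
    refine ((d₁.mul d₂).neg.div_const (η * (t - c))).congr_deriv ?_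
    have e₁ : (t - x) ^ η = (t - x) ^ (η - 1) * (t - x) := by
      rw [← Real.rpow_add_one h₁.ne', sub_add_cancel]
    have e₂ : (x - c) ^ (-η) = (x - c) ^ (-η - 1) * (x - c) := by
      rw [← Real.rpow_add_one h₂.ne', sub_add_cancel]
    simp only [id]
    rw [e₁, e₂]
    field_simp
    ring
  have hint : IntervalIntegrable
      (fun s : ℝ => (t - s) ^ (η - 1) * (s - c) ^ (-η - 1)) volume p t := by
    rw [intervalIntegrable_iff_integrableOn_Ioc_of_le hpt.le]
    refine integrableOn_deriv_of_nonneg hcont hderiv fun x hx => mul_nonneg ?_ ?_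
    · exact Real.rpow_nonneg (by linarith [hx.2]) _
    · exact Real.rpow_nonneg (by linarith [hx.1]) _
  rw [integral_eq_sub_of_hasDerivAt_of_le hpt.le hcont hderiv hint,
    sub_self, Real.zero_rpow hη0.ne', Real.rpow_neg (by linarith : 0 ≤ p - c)]
  have hpc : 0 < (p - c) ^ η := Real.rpow_pos_of_pos (by linarith) _
  field_simp
  ring
end

section
/- Let 0 < η < 1, let C ≥ 0, let p < t₁ < P < t be real numbers, and let g : ℝ → ℝ be a measurable function with 0 ≤ g(u) and (u−p)^{1−η} g(u) ≤ C for all u ∈ (p, t₁]. Then (t−P)^{1−η} ∫_{P}^{t} ∫_{p}^{t₁} (t−s)^{η−1} · g(u) / (s−u)^{η+1} du ds ≤ (C/η²) · ( (t₁−p) / (P−t₁) )^{η}. -/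
open MeasureTheory intervalIntegral

theorem intervalIntegrable_rpow_sub_mul_rpow_sub {η a b c : ℝ} (hη : 0 < η) (hca : c < a)
    (hab : a ≤ b) :
    IntervalIntegrable (fun s => (b - s) ^ (η - 1) * (s - c) ^ (-η - 1)) volume a b := by
  apply IntervalIntegrable.mul_continuousOn
  · have h := (intervalIntegrable_rpow' (a := b - a) (b := b - b)
      (by linarith : -1 < η - 1)).comp_sub_left b
    simpa using h
  · intro s hs
    rw [Set.uIcc_of_le hab] at hs
    exact ((continuousAt_id.sub continuousAt_const).rpow_const
      (Or.inl (sub_pos.2 (hca.trans_le hs.1)).ne')).continuousWithinAt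

theorem integral_rpow_sub_mul_rpow_sub {η a b c : ℝ} (hη : 0 < η) (hca : c < a) (hab : a ≤ b) :
    ∫ s in a..b, (b - s) ^ (η - 1) * (s - c) ^ (-η - 1) =
      (η * (b - c))⁻¹ * ((b - a) ^ η * (a - c) ^ (-η)) := by
  have hcb : 0 < b - c := by linarith
  have key := integral_eq_sub_of_hasDerivAt_of_le (a := a) (b := b)
    (f := fun s => -(η * (b - c))⁻¹ * ((b - s) ^ η * (s - c) ^ (-η)))
    (f' := fun s => (b - s) ^ (η - 1) * (s - c) ^ (-η - 1)) hab ?_ ?_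
    (intervalIntegrable_rpow_sub_mul_rpow_sub hη hca hab)
  · rw [key]
    simp [Real.zero_rpow hη.ne']
  · intro s hs
    refine ContinuousAt.continuousWithinAt (continuousAt_const.mul (.mul ?_ ?_))
    · exact (continuousAt_const.sub continuousAt_id).rpow_const (Or.inr hη.le)
    · exact (continuousAt_id.sub continuousAt_const).rpow_const
        (Or.inl (sub_pos.2 (hca.trans_le hs.1)).ne')
  · intro s hs
    have h1 : 0 < b - s := sub_pos.2 hs.2
    have h2 : 0 < s - c := by linarith [hs.1]
    have d1 := ((hasDerivAt_id s).const_sub b).rpow_const (p := η) (Or.inl h1.ne')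
    have d2 := ((hasDerivAt_id s).sub_const c).rpow_const (p := -η) (Or.inl h2.ne')
    refine ((d1.mul d2).const_mul (-(η * (b - c))⁻¹)).congr_deriv ?_
    have e1 : (b - s) ^ η = (b - s) ^ (η - 1) * (b - s) := by
      rw [Real.rpow_sub_one h1.ne']; field_simp
    have e2 : (s - c) ^ (-η) = (s - c) ^ (-η - 1) * (s - c) := by
      rw [Real.rpow_sub_one h2.ne']; field_simp
    simp only [id, e1, e2]
    field_simp
    ring

theorem intervalIntegrable_rpow_sub_mul_rpow_sub' {η a b c : ℝ} (hη : 0 < η) (hab : a ≤ b)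
    (hbc : b < c) :
    IntervalIntegrable (fun s => (s - a) ^ (η - 1) * (c - s) ^ (-η - 1)) volume a b := by
  have h := (intervalIntegrable_rpow_sub_mul_rpow_sub hη (neg_lt_neg hbc)
    (neg_le_neg hab)).comp_sub_left 0
  have h' := h.symm
  simp only [zero_sub, sub_neg_eq_add] at h'
  convert h' using 5 <;> ring

theorem integral_rpow_sub_mul_rpow_sub' {η a b c : ℝ} (hη : 0 < η) (hab : a ≤ b) (hbc : b < c) :
    ∫ s in a..b, (s - a) ^ (η - 1) * (c - s) ^ (-η - 1) =
      (η * (c - a))⁻¹ * ((b - a) ^ η * (c - b) ^ (-η)) := by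
  have h := integral_rpow_sub_mul_rpow_sub hη (neg_lt_neg hbc) (neg_le_neg hab)
  rw [← integral_comp_neg] at h
  simpa only [sub_neg_eq_add, neg_add_eq_sub] using h

theorem integral_le_integral_of_nonneg_of_le {f h : ℝ → ℝ} {a b : ℝ} (hab : a ≤ b)
    (hf : ∀ x ∈ Set.Ioc a b, 0 ≤ f x) (hh : IntervalIntegrable h volume a b)
    (hfh : ∀ x ∈ Set.Ioc a b, f x ≤ h x) : ∫ x in a..b, f x ≤ ∫ x in a..b, h x := by
  rw [integral_of_le hab, integral_of_le hab]
  exact integral_mono_of_nonneg (ae_restrict_of_forall_mem measurableSet_Ioc hf)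
    ((intervalIntegrable_iff_integrableOn_Ioc_of_le hab).1 hh)
    (ae_restrict_of_forall_mem measurableSet_Ioc hfh)

/-- If `0 ≤ g` and `(u−p)^{1−η} g(u) ≤ C` on `(p, t₁]`, then for `p < t₁ < P < t`,
`(t−P)^{1−η} ∫_{P}^{t} ∫_{p}^{t₁} (t−s)^{η−1} g(u)/(s−u)^{η+1} du ds
  ≤ (C/η²) ((t₁−p)/(P−t₁))^{η}`. -/
theorem double_integral_weighted_bound (η C p t₁ P t : ℝ) (hη0 : 0 < η) (hη1 : η < 1)
    (hC : 0 ≤ C) (hpt₁ : p < t₁) (ht₁P : t₁ < P) (hPt : P < t) (g : ℝ → ℝ)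
    (hg : Measurable g) (hg0 : ∀ u ∈ Set.Ioc p t₁, 0 ≤ g u)
    (hgC : ∀ u ∈ Set.Ioc p t₁, (u - p) ^ (1 - η) * g u ≤ C) :
    (t - P) ^ (1 - η) *
        ∫ s in P..t, ∫ u in p..t₁, (t - s) ^ (η - 1) * (g u / (s - u) ^ (η + 1)) ≤
      C / η ^ 2 * ((t₁ - p) / (P - t₁)) ^ η := by
  have hnonneg : ∀ s ∈ Set.Ioc P t, ∀ u ∈ Set.Ioc p t₁,
      0 ≤ (t - s) ^ (η - 1) * (g u / (s - u) ^ (η + 1)) := fun s hs u hu =>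
    mul_nonneg (Real.rpow_nonneg (sub_nonneg.2 hs.2) _)
      (div_nonneg (hg0 u hu) (Real.rpow_nonneg (by linarith [hs.1, hu.2]) _))
  have hpointwise : ∀ s ∈ Set.Ioc P t, ∀ u ∈ Set.Ioc p t₁,
      (t - s) ^ (η - 1) * (g u / (s - u) ^ (η + 1)) ≤
        ((t - s) ^ (η - 1) * C) * ((u - p) ^ (η - 1) * (s - u) ^ (-η - 1)) := by
    intro s hs u hu
    have hup : 0 < u - p := sub_pos.2 hu.1
    have hsu : 0 < s - u := by linarith [hs.1, hu.2]
    have hgu : g u ≤ C * (u - p) ^ (η - 1) := by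
      rw [← neg_sub 1 η, Real.rpow_neg hup.le, ← div_eq_mul_inv,
        le_div_iff₀ (Real.rpow_pos_of_pos hup _), mul_comm]
      exact hgC u hu
    rw [div_eq_mul_inv, ← Real.rpow_neg hsu.le, neg_add', mul_assoc, ← mul_assoc C]
    exact mul_le_mul_of_nonneg_left
      (mul_le_mul_of_nonneg_right hgu (Real.rpow_nonneg hsu.le _))
      (Real.rpow_nonneg (sub_nonneg.2 hs.2) _)
  have hinner : ∀ s ∈ Set.Ioc P t,
      ∫ u in p..t₁, (t - s) ^ (η - 1) * (g u / (s - u) ^ (η + 1)) ≤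
        (C / η * (t₁ - p) ^ η) * ((t - s) ^ (η - 1) * (s - t₁) ^ (-η - 1)) := by
    intro s hs
    have hts : t₁ < s := ht₁P.trans hs.1
    have hst : 0 < s - t₁ := sub_pos.2 hts
    refine (integral_le_integral_of_nonneg_of_le hpt₁.le (hnonneg s hs)
      ((intervalIntegrable_rpow_sub_mul_rpow_sub' hη0 hpt₁.le hts).const_mul _)
      (hpointwise s hs)).trans ?_
    rw [intervalIntegral.integral_const_mul, integral_rpow_sub_mul_rpow_sub' hη0 hpt₁.le hts,
      Real.rpow_sub_one hst.ne', mul_inv, div_eq_mul_inv, div_eq_mul_inv]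
    have hinv : (s - p)⁻¹ ≤ (s - t₁)⁻¹ := inv_anti₀ hst (by linarith)
    have hcoef : 0 ≤ (t - s) ^ (η - 1) * C * η⁻¹ * (t₁ - p) ^ η * (s - t₁) ^ (-η) := by
      have := Real.rpow_nonneg (sub_nonneg.2 hs.2) (η - 1)
      have := sub_pos.2 hpt₁
      positivity
    linarith [mul_le_mul_of_nonneg_left hinv hcoef]
  have houter : ∫ s in P..t, ∫ u in p..t₁, (t - s) ^ (η - 1) * (g u / (s - u) ^ (η + 1)) ≤
      (C / η * (t₁ - p) ^ η) * ((η * (t - t₁))⁻¹ * ((t - P) ^ η * (P - t₁) ^ (-η))) := by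
    rw [← integral_rpow_sub_mul_rpow_sub hη0 ht₁P hPt.le, ← intervalIntegral.integral_const_mul]
    refine integral_le_integral_of_nonneg_of_le hPt.le (fun s hs => ?_)
      ((intervalIntegrable_rpow_sub_mul_rpow_sub hη0 ht₁P hPt.le).const_mul _) hinner
    rw [integral_of_le hpt₁.le]
    exact setIntegral_nonneg measurableSet_Ioc (hnonneg s hs)
  have htP : 0 < t - P := sub_pos.2 hPt
  have hPt₁ : 0 < P - t₁ := sub_pos.2 ht₁P
  have htt₁ : 0 < t - t₁ := by linarith
  have hp : 0 < t₁ - p := sub_pos.2 hpt₁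
  have hpow : (t - P) ^ (1 - η) * (t - P) ^ η = t - P := by
    rw [← Real.rpow_add htP, sub_add_cancel, Real.rpow_one]
  calc _ ≤ (t - P) ^ (1 - η) * ((C / η * (t₁ - p) ^ η) *
          ((η * (t - t₁))⁻¹ * ((t - P) ^ η * (P - t₁) ^ (-η)))) :=
        mul_le_mul_of_nonneg_left houter (Real.rpow_nonneg htP.le _)
    _ = C / η ^ 2 * ((t₁ - p) / (P - t₁)) ^ η *
          (((t - P) ^ (1 - η) * (t - P) ^ η) / (t - t₁)) := by
        rw [Real.div_rpow hp.le hPt₁.le, Real.rpow_neg hPt₁.le]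
        field_simp
    _ ≤ C / η ^ 2 * ((t₁ - p) / (P - t₁)) ^ η := by
        rw [hpow]
        exact mul_le_of_le_one_right (by positivity) ((div_le_one htt₁).2 (by linarith))
end
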